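/- For every formula A of L(∀,□) and all Γ, Δ ∈ MC: □A ∈ Γ if and only if □A ∈ Δ. -/

import Mathlib

namespace FOLBoxPaper

/-- Formulas of the language L(∀,□): atoms `P_j(x₁,…,xₙ)` (predicate index and
list of variables), identity `x = y`, negation, implication, universal
quantification, and the modal operator □. Variables are natural numbers. -/
inductive Formula : Type
  | atom : ℕ → List ℕ → Formula
  | eq : ℕ → ℕ → Formula
  | neg : Formula → Formula
  | imp : Formula → Formula → Formula
  | all : ℕ → Formula → Formula
  | box : Formula → Formula

namespace Formula

/-- Conjunction, defined as usual. -/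
def and (A B : Formula) : Formula := neg (imp A (neg B))

/-- Disjunction, defined as usual. -/
def or (A B : Formula) : Formula := imp (neg A) B

/-- Biconditional, defined as usual. -/
def iff (A B : Formula) : Formula := (imp A B).and (imp B A)

/-- ◇A := ¬□¬A. -/
def dia (A : Formula) : Formula := neg (box (neg A))

/-- ∃xA := ¬∀x¬A. -/
def ex (x : ℕ) (A : Formula) : Formula := neg (all x (neg A))

/-- A formula is □-free when it contains no occurrence of □. -/
def BoxFree : Formula → Prop
  | atom _ _ => True
  | eq _ _ => True
  | neg A => BoxFree A
  | imp A B => BoxFree A ∧ BoxFree B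
  | all _ A => BoxFree A
  | box _ => False

/-- `FreeIn x A`: the variable x has at least one ∀□-free occurrence in A,
i.e. an occurrence that is neither in the scope of a quantifier binding x
nor in the scope of □. -/
def FreeIn (x : ℕ) : Formula → Prop
  | atom _ args => x ∈ args
  | eq a b => x = a ∨ x = b
  | neg A => FreeIn x A
  | imp A B => FreeIn x A ∨ FreeIn x B
  | all z A => z ≠ x ∧ FreeIn x A
  | box _ => False

/-- The ∀□-free substitution `A(y/x)`: replace every ∀□-free occurrence of x
in A by y (occurrences in the scope of □ or of a quantifier binding x are
left untouched). -/
def subst (A : Formula) (y x : ℕ) : Formula :=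
  match A with
  | atom j args => atom j (args.map fun z => if z = x then y else z)
  | eq a b => eq (if a = x then y else a) (if b = x then y else b)
  | neg A => neg (subst A y x)
  | imp A B => imp (subst A y x) (subst B y x)
  | all z A => if z = x then all z A else all z (subst A y x)
  | box A => box A

/-- `Substitutable y x A`: the variable y is substitutable for the ∀□-free
occurrences of x in A, i.e. y is not captured by a quantifier when it
replaces x. -/
def Substitutable (y x : ℕ) : Formula → Prop
  | atom _ _ => True
  | eq _ _ => True
  | neg A => Substitutable y x A
  | imp A B => Substitutable y x A ∧ Substitutable y x B
  | all z A => z = x ∨ ¬ FreeIn x A ∨ (z ≠ y ∧ Substitutable y x A)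
  | box _ => True

end Formula

open Formula

/-- A first-order structure with variable domains:
a nonempty set of possible worlds, a nonempty domain of objects for each
world, and a world-relative interpretation of the predicate symbols. -/
structure Structure where
  W : Type
  wNonempty : Nonempty W
  D : W → Type
  dNonempty : ∀ w, Nonempty (D w)
  I : ℕ → (w : W) → List (D w) → Prop

/-- A valuation assigns, to each variable and world, an object of the domain
of that world. -/
def Valuation (M : Structure) : Type := ℕ → (w : M.W) → M.D w

open Classical in
/-- The variant `v^a_x(w)` of a valuation v at world w: it maps x at w to a
and agrees with v everywhere else. -/
noncomputable def updateVal {M : Structure} (v : Valuation M) (x : ℕ)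
    (w : M.W) (a : M.D w) : Valuation M :=
  fun y w' => if h : y = x ∧ w' = w then cast (congrArg M.D h.2.symm) a else v y w'

/-- Satisfaction `M, v, w ⊨ A`. The clause for □ quantifies over all
valuations and all worlds of the structure. -/
def Sat (M : Structure) : Valuation M → M.W → Formula → Prop
  | v, w, .atom j args => M.I j w (args.map fun z => v z w)
  | v, w, .eq a b => v a w = v b w
  | v, w, .neg A => ¬ Sat M v w A
  | v, w, .imp A B => Sat M v w A → Sat M v w B
  | v, w, .all x A => ∀ a : M.D w, Sat M (updateVal v x w a) w A
  | _, _, .box A => ∀ (v' : Valuation M) (w' : M.W), Sat M v' w' A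

/-- `M ⊨ A`: A is satisfied at every valuation and world of M. -/
def Models (M : Structure) (A : Formula) : Prop := ∀ v w, Sat M v w A

/-- Universal structures: M is universal when every □-free formula true
everywhere in M is true everywhere in every structure. -/
def Universal (M : Structure) : Prop :=
  ∀ B, BoxFree B → Models M B → ∀ N : Structure, Models N B

/-- Logical validity: truth at every valuation and world of every universal
structure. -/
def Valid (A : Formula) : Prop :=
  ∀ M : Structure, Universal M → ∀ (v : Valuation M) (w : M.W), Sat M v w A

/-- FOL: the set of □-free classical first-order theses, i.e. □-free formulas
satisfied at every valuation and world of every structure. -/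
def FOL : Set Formula := {A | BoxFree A ∧ ∀ M : Structure, Models M A}

/-- `PropTaut A`: A is an instantiation of a tautology of classical
propositional logic (it is true under every assignment of truth values to
formulas that respects ¬ and →). -/
def PropTaut (A : Formula) : Prop :=
  ∀ f : Formula → Prop,
    (∀ B, f (neg B) ↔ ¬ f B) → (∀ B C, f (imp B C) ↔ (f B → f C)) → f A

/-- The system FOL□. -/
inductive FOLBox : Formula → Prop
  | taut {A} : PropTaut A → FOLBox A
  | axK {A B} : FOLBox ((box (A.imp B)).imp ((box A).imp (box B)))
  | axT {A} : FOLBox ((box A).imp A)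
  | ax5 {A} : FOLBox ((neg (box A)).imp (box (neg (box A))))
  | axAll1 {A : Formula} {x y : ℕ} : Substitutable y x A →
      FOLBox ((all x A).imp (A.subst y x))
  | axAll2 {A B : Formula} {x : ℕ} : ¬ FreeIn x A →
      FOLBox ((all x (A.imp B)).imp (A.imp (all x B)))
  | axId {x : ℕ} : FOLBox (Formula.eq x x)
  | axEq {A : Formula} {x y : ℕ} : BoxFree A → Substitutable y x A →
      FOLBox (((Formula.eq x y).and A).imp (A.subst y x))
  | axMix {A : Formula} {x : ℕ} : FOLBox ((box A).imp (all x A))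
  | axBang {A} : BoxFree A → A ∉ FOL → FOLBox (neg (box A))
  | mp {A B} : FOLBox (A.imp B) → FOLBox A → FOLBox B
  | nec {A} : FOLBox A → FOLBox (box A)

/-- The conjunction of a (nonempty) finite list of formulas. -/
def conjList : List Formula → Formula
  | [] => Formula.eq 0 0
  | [A] => A
  | A :: B :: rest => A.and (conjList (B :: rest))

/-- FOL□-consistency: no finite conjunction of members of Γ has its negation
in FOL□. -/
def Consistent (Γ : Set Formula) : Prop :=
  ∀ L : List Formula, L ≠ [] → (∀ B ∈ L, B ∈ Γ) → ¬ FOLBox (neg (conjList L))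

/-- Maximal FOL□-consistency. -/
def MaxConsistent (Γ : Set Formula) : Prop :=
  Consistent Γ ∧ ∀ A, A ∈ Γ ∨ neg A ∈ Γ

/-- ∃-saturation: whenever ¬∀xA ∈ Γ there is a variable y with
¬A(y/x) ∈ Γ via a ∀□-free substitution. -/
def Saturated (Γ : Set Formula) : Prop :=
  ∀ (x : ℕ) (A : Formula), neg (all x A) ∈ Γ →
    ∃ y : ℕ, Substitutable y x A ∧ neg (A.subst y x) ∈ Γ

/-- MC: the family of all ∃-saturated maximal FOL□-consistent sets. -/
def MC : Set (Set Formula) := {Γ | Saturated Γ ∧ MaxConsistent Γ}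

/-- An elementary disjunction: a formula of the form
`A ∨ ◇B ∨ □C₁ ∨ … ∨ □Cₙ` with A, B, C₁, …, Cₙ □-free. -/
def ElemDisj (D : Formula) : Prop :=
  ∃ (A B : Formula) (Cs : List Formula),
    BoxFree A ∧ BoxFree B ∧ (∀ C ∈ Cs, BoxFree C) ∧
    D = (Cs.map Formula.box).foldl Formula.or (A.or B.dia)

/-- A conjunctive form: a conjunction of elementary disjunctions. -/
def ConjForm (F : Formula) : Prop :=
  ∃ Ds : List Formula, Ds ≠ [] ∧ (∀ D ∈ Ds, ElemDisj D) ∧ F = conjList Ds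

/-- The worlds of the canonical structure: members of MC. -/
def MCW : Type := {Γ : Set Formula // Γ ∈ MC}

/-- The relation ∼_Γ on variables: x ∼_Γ y iff the formula x = y belongs
to Γ. -/
def canonRel (Γ : MCW) (x y : ℕ) : Prop := Formula.eq x y ∈ Γ.val

/-- The canonical structure 𝒜^MC: worlds are the members of MC, the domain
of a world Γ consists of the classes [x]_{∼_Γ} of variables, and a predicate
holds of such classes iff the corresponding atomic formula belongs to Γ. -/
noncomputable def canonicalStructure (h : Nonempty MCW) : Structure where
  W := MCW
  wNonempty := h
  D := fun Γ => Quot (canonRel Γ)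
  dNonempty := fun Γ => ⟨Quot.mk _ 0⟩
  I := fun j Γ ds =>
    ∃ xs : List ℕ, ds = xs.map (Quot.mk (canonRel Γ)) ∧ Formula.atom j xs ∈ Γ.val

/-- The canonical valuation v^MC: v^MC(x, Γ) = [x]_{∼_Γ}. -/
noncomputable def canonicalVal (h : Nonempty MCW) : Valuation (canonicalStructure h) :=
  fun x Γ => Quot.mk (canonRel Γ) x

namespace Formula

/-- The number of connectives of a formula. -/
def size : Formula → ℕ
  | atom _ _ => 0
  | eq _ _ => 0
  | neg A => size A + 1
  | imp A B => size A + size B + 1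
  | all _ A => size A + 1
  | box A => size A + 1

theorem size_subst (A : Formula) (y x : ℕ) : (A.subst y x).size = A.size := by
  induction A with
  | all z A ih => simp only [subst]; split_ifs <;> simp [size, ih]
  | _ => simp_all [subst, size]

theorem boxFree_subst {A : Formula} (h : BoxFree A) (y x : ℕ) : BoxFree (A.subst y x) := by
  induction A with
  | all z A ih => simp only [subst]; split_ifs <;> simp_all [BoxFree]
  | _ => simp_all [subst, BoxFree]

theorem subst_self (A : Formula) (x : ℕ) : A.subst x x = A := by
  induction A with
  | atom j l =>
    have h : (fun z => if z = x then x else z) = id := by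
      funext z; simp +contextual [eq_comm]
    simp [subst, h]
  | eq a b => simp +contextual [subst, eq_comm]
  | _ => simp_all [subst]

theorem substitutable_self (A : Formula) (x : ℕ) : Substitutable x x A := by
  induction A with
  | all z A ih => simp only [Substitutable]; tauto
  | _ => simp_all [Substitutable]

theorem subst_of_not_freeIn {A : Formula} {x : ℕ} (h : ¬ FreeIn x A) (y : ℕ) :
    A.subst y x = A := by
  induction A with
  | atom j l =>
    simp only [subst, atom.injEq, true_and]
    refine (List.map_congr_left fun z hz => ?_).trans (List.map_id l)
    rw [if_neg (by rintro rfl; exact h hz)]; rfl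
  | eq a b => simp_all [subst, FreeIn, eq_comm]
  | neg A ih => simp_all [subst, FreeIn]
  | imp A B ihA ihB => simp_all [subst, FreeIn]
  | all z A ih =>
    simp only [subst, FreeIn] at *
    split_ifs with hz
    · rfl
    · rw [ih (by tauto)]
  | box A ih => rfl

theorem not_freeIn_subst (A : Formula) {x y : ℕ} (h : y ≠ x) : ¬ FreeIn x (A.subst y x) := by
  induction A with
  | atom j l =>
    simp only [subst, FreeIn, List.mem_map, not_exists, not_and]
    intro z _
    split_ifs <;> assumption
  | eq a b =>
    simp only [subst, FreeIn]
    split_ifs <;> grind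
  | all z A ih => simp only [subst]; split_ifs <;> simp_all [FreeIn]
  | _ => simp_all [subst, FreeIn]

/-- All large enough variables are fresh for `A`, and substituting such a variable for `x` can
be undone. -/
theorem exists_fresh (A : Formula) (x : ℕ) : ∃ n, ∀ y ≥ n, ¬ FreeIn y A ∧ Substitutable y x A ∧
    Substitutable x y (A.subst y x) ∧ (A.subst y x).subst x y = A := by
  induction A with
  | atom j l =>
    refine ⟨l.sum + 1, fun y hy => ?_⟩
    have hl : ∀ z ∈ l, z ≠ y := fun z hz => by have := List.le_sum_of_mem hz; omega
    refine ⟨fun h => hl y h rfl, trivial, trivial, ?_⟩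
    simp only [subst, List.map_map, atom.injEq, true_and]
    refine (List.map_congr_left fun z hz => ?_).trans (List.map_id l)
    have := hl z hz
    simp only [Function.comp, id]
    split_ifs <;> simp_all
  | eq a b =>
    refine ⟨a + b + 1, fun y hy => ⟨?_, trivial, trivial, ?_⟩⟩
    · simp only [FreeIn]; omega
    · simp only [subst, eq.injEq]
      constructor <;> split_ifs <;> omega
  | neg A ih =>
    obtain ⟨n, hn⟩ := ih
    exact ⟨n, fun y hy => by simpa [FreeIn, Substitutable, subst] using hn y hy⟩
  | imp A B ihA ihB =>
    obtain ⟨n, hn⟩ := ihA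
    obtain ⟨m, hm⟩ := ihB
    refine ⟨n + m, fun y hy => ?_⟩
    have h1 := hn y (by omega)
    have h2 := hm y (by omega)
    simp_all [FreeIn, Substitutable, subst]
  | all z A ih =>
    obtain ⟨n, hn⟩ := ih
    refine ⟨n + z + 1, fun y hy => ?_⟩
    obtain ⟨h1, h2, h3, h4⟩ := hn y (by omega)
    have hzy : z ≠ y := by omega
    by_cases hz : z = x
    · simp [FreeIn, Substitutable, subst, hz, h1, subst_of_not_freeIn h1]
    · simp [FreeIn, Substitutable, subst, hz, h1, h2, h3, h4, hzy]
  | box A ih => exact ⟨0, fun y _ => ⟨id, trivial, trivial, rfl⟩⟩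

/-- An injective numbering of formulas. -/
def code : Formula → ℕ
  | atom j l => Nat.pair 0 (Nat.pair j (Encodable.encode l))
  | eq a b => Nat.pair 1 (Nat.pair a b)
  | neg A => Nat.pair 2 (code A)
  | imp A B => Nat.pair 3 (Nat.pair (code A) (code B))
  | all x A => Nat.pair 4 (Nat.pair x (code A))
  | box A => Nat.pair 5 (code A)

theorem code_injective : Function.Injective code := by
  intro A
  induction A with
  | neg A ih => intro B h; cases B <;> simp [code, Nat.pair_eq_pair] at h ⊢; exact ih h
  | imp A B ihA ihB =>
    intro C h; cases C <;> simp [code, Nat.pair_eq_pair] at h ⊢; exact ⟨ihA h.1, ihB h.2⟩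
  | all x A ih => intro B h; cases B <;> simp [code, Nat.pair_eq_pair] at h ⊢; exact ⟨h.1, ih h.2⟩
  | box A ih => intro B h; cases B <;> simp [code, Nat.pair_eq_pair] at h ⊢; exact ih h
  | _ => intro B h; cases B <;> simp_all [code, Nat.pair_eq_pair]

instance : Countable Formula := code_injective.countable

instance : Nonempty Formula := ⟨eq 0 0⟩

end Formula

section Semantics

variable {M : Structure}

theorem updateVal_self (v : Valuation M) (x : ℕ) (w : M.W) (a : M.D w) :
    updateVal v x w a x w = a := by
  simp [updateVal]

theorem updateVal_of_ne (v : Valuation M) {x z : ℕ} (w : M.W) (a : M.D w) (h : z ≠ x) :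
    updateVal v x w a z w = v z w := by
  simp [updateVal, h]

theorem sat_congr {A : Formula} {v v' : Valuation M} {w : M.W}
    (h : ∀ z, FreeIn z A → v z w = v' z w) : Sat M v w A ↔ Sat M v' w A := by
  induction A generalizing v v' with
  | atom j l => simp only [Sat]; rw [List.map_congr_left fun z hz => h z hz]
  | eq a b => simp only [Sat]; rw [h a (Or.inl rfl), h b (Or.inr rfl)]
  | neg A ih => simp only [Sat]; rw [ih h]
  | imp A B ihA ihB =>
    simp only [Sat]
    rw [ihA fun z hz => h z (Or.inl hz), ihB fun z hz => h z (Or.inr hz)]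
  | all x A ih =>
    simp only [Sat]
    refine forall_congr' fun a => ih fun z hz => ?_
    by_cases hzx : z = x
    · subst hzx; simp only [updateVal_self]
    · simp only [updateVal_of_ne _ _ _ hzx]
      exact h z ⟨Ne.symm hzx, hz⟩
  | box A => rfl

theorem sat_subst {A : Formula} {x y : ℕ} (hA : Substitutable y x A) (v : Valuation M) (w : M.W) :
    Sat M v w (A.subst y x) ↔ Sat M (updateVal v x w (v y w)) w A := by
  have key : ∀ (v : Valuation M) (z : ℕ),
      v (if z = x then y else z) w = updateVal v x w (v y w) z w := by
    intro v z
    split_ifs with h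
    · subst h; rw [updateVal_self]
    · rw [updateVal_of_ne _ _ _ h]
  induction A generalizing v with
  | atom j l =>
    simp only [subst, Sat, List.map_map, Function.comp_def, key]
  | eq a b => simp only [subst, Sat, key]
  | neg A ih => exact not_congr (ih hA v)
  | imp A B ihA ihB => exact imp_congr (ihA hA.1 v) (ihB hA.2 v)
  | all z A ih =>
    by_cases hfree : FreeIn x (all z A)
    · obtain ⟨hzx, hxA⟩ := hfree
      obtain ⟨hzy, hs⟩ : z ≠ y ∧ Substitutable y x A := by
        rcases hA with h | h | h
        · exact absurd h hzx
        · exact absurd hxA h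
        · exact h
      simp only [subst, if_neg hzx, Sat]
      refine forall_congr' fun a => (ih hs _).trans (sat_congr fun u _ => ?_)
      rw [updateVal_of_ne _ _ _ hzy.symm]
      by_cases hux : u = x
      · subst hux; rw [updateVal_self, updateVal_of_ne _ _ _ hzx.symm, updateVal_self]
      · rw [updateVal_of_ne _ _ _ hux]
        by_cases huz : u = z
        · subst huz; simp only [updateVal_self]
        · simp only [updateVal_of_ne _ _ _ huz, updateVal_of_ne _ _ _ hux]
    · rw [subst_of_not_freeIn hfree]
      refine sat_congr fun u hu => ?_
      rw [updateVal_of_ne]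
      rintro rfl
      exact hfree hu
  | box A => rfl

end Semantics

namespace FOLBox

theorem mp_taut {A B : Formula} (hA : FOLBox A) (h : PropTaut (A.imp B)) : FOLBox B :=
  (taut h).mp hA

theorem mp_taut₂ {A B C : Formula} (hA : FOLBox A) (hB : FOLBox B)
    (h : PropTaut (A.imp (B.imp C))) : FOLBox C :=
  ((taut h).mp hA).mp hB

theorem trans {A B C : Formula} (h₁ : FOLBox (A.imp B)) (h₂ : FOLBox (B.imp C)) :
    FOLBox (A.imp C) :=
  mp_taut₂ h₁ h₂ fun f _ hi => by simp only [hi]; tauto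

theorem gen {A : Formula} (x : ℕ) (h : FOLBox A) : FOLBox (all x A) :=
  axMix.mp h.nec

theorem all_imp_self (A : Formula) (x : ℕ) : FOLBox ((all x A).imp A) := by
  simpa only [subst_self] using axAll1 (substitutable_self A x)

theorem imp_all {A B : Formula} {x : ℕ} (hx : ¬ FreeIn x A) (h : FOLBox (A.imp B)) :
    FOLBox (A.imp (all x B)) :=
  (axAll2 hx).mp (h.gen x)

theorem all_mono {A B : Formula} (x : ℕ) (h : FOLBox (A.imp B)) :
    FOLBox ((all x A).imp (all x B)) :=
  imp_all (by simp [FreeIn]) ((all_imp_self A x).trans h)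

theorem box_mono {A B : Formula} (h : FOLBox (A.imp B)) : FOLBox ((box A).imp (box B)) :=
  axK.mp h.nec

end FOLBox

/-- `A` is FOL□-consistent. -/
def Con (A : Formula) : Prop := ¬ FOLBox (neg A)

theorem Con.and_or_and_neg {A : Formula} (h : Con A) (B : Formula) :
    Con (A.and B) ∨ Con (A.and (neg B)) := by
  by_contra! hc
  simp only [Con, not_not] at hc
  exact h (hc.1.mp_taut₂ hc.2 fun f hn hi => by simp only [hi, hn, Formula.and]; tauto)

theorem Con.exists_witness {A C : Formula} {x : ℕ} (h : Con (A.and (neg (all x C)))) :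
    ∃ y, Substitutable y x C ∧ Con ((A.and (neg (all x C))).and (neg (C.subst y x))) := by
  obtain ⟨n, hn⟩ := exists_fresh C x
  obtain ⟨m, hm⟩ := exists_fresh (A.and (neg (all x C))) x
  obtain ⟨y, hy⟩ : ∃ y, y = n + m + x + 1 := ⟨_, rfl⟩
  obtain ⟨-, h2, h3, h4⟩ := hn y (by omega)
  have h5 := (hm y (by omega)).1
  refine ⟨y, h2, fun hc => h ?_⟩
  have h6 : FOLBox ((A.and (neg (all x C))).imp (C.subst y x)) :=
    hc.mp_taut fun f hn hi => by simp only [hi, hn, Formula.and]; tauto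
  have h7 : FOLBox ((all y (C.subst y x)).imp C) := by
    simpa only [h4] using FOLBox.axAll1 h3
  have h8 := FOLBox.imp_all (x := x)
    (by simp only [FreeIn, not_and]; exact fun _ => not_freeIn_subst C (by omega)) h7
  exact ((FOLBox.imp_all h5 h6).trans h8).mp_taut fun f hn hi => by
    simp only [hi, hn, Formula.and]; tauto

theorem Con.exists_extension {A : Formula} (h : Con A) (B : Formula) :
    ∃ A', Con A' ∧ FOLBox (A'.imp A) ∧ (FOLBox (A'.imp B) ∨ FOLBox (A'.imp (neg B))) ∧
      ∀ x C, B = neg (all x C) → FOLBox (A'.imp B) →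
        ∃ y, Substitutable y x C ∧ FOLBox (A'.imp (neg (C.subst y x))) := by
  by_cases hB : Con (A.and B)
  · by_cases hw : ∃ x C, B = neg (all x C)
    · obtain ⟨x, C, rfl⟩ := hw
      obtain ⟨y, hy, hc⟩ := hB.exists_witness
      refine ⟨_, hc, .taut fun f hn hi => ?_, Or.inl (.taut fun f hn hi => ?_), ?_⟩
      · simp only [hi, hn, Formula.and]; tauto
      · simp only [hi, hn, Formula.and]; tauto
      · intro x' C' he _
        simp only [neg.injEq, all.injEq] at he
        obtain ⟨rfl, rfl⟩ := he
        exact ⟨y, hy, .taut fun f hn hi => by simp only [hi, hn, Formula.and]; tauto⟩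
    · refine ⟨_, hB, .taut fun f hn hi => ?_, Or.inl (.taut fun f hn hi => ?_),
        fun x C he => absurd ⟨x, C, he⟩ hw⟩
      · simp only [hi, hn, Formula.and]; tauto
      · simp only [hi, hn, Formula.and]; tauto
  · have hB' := (h.and_or_and_neg B).resolve_left hB
    have hn : FOLBox ((A.and (neg B)).imp (neg B)) :=
      .taut fun f hn hi => by simp only [hi, hn, Formula.and]; tauto
    refine ⟨_, hB', .taut fun f hn hi => ?_, Or.inr hn, fun _ _ _ hc => absurd ?_ hB'⟩
    · simp only [hi, hn, Formula.and]; tauto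
    · exact hn.mp_taut₂ hc fun f hn hi => by simp only [hi, hn, Formula.and]; tauto

/-- A deductively closed, negation-complete, ∃-saturated set of formulas. -/
structure Henkin (Γ : Set Formula) : Prop where
  of_folBox : ∀ {A}, FOLBox A → A ∈ Γ
  mp : ∀ {A B}, A.imp B ∈ Γ → A ∈ Γ → B ∈ Γ
  neg_mem : ∀ {A}, neg A ∈ Γ ↔ A ∉ Γ
  saturated : Saturated Γ

theorem Con.exists_henkin {A : Formula} (h : Con A) : ∃ Γ, Henkin Γ ∧ A ∈ Γ := by
  obtain ⟨e, he⟩ := exists_surjective_nat Formula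
  choose g hg1 hg2 hg3 hg4 using @Con.exists_extension
  let s : ℕ → {A : Formula // Con A} :=
    Nat.rec ⟨A, h⟩ fun n p => ⟨g p.2 (e n), hg1 p.2 (e n)⟩
  have hs : ∀ {n m}, n ≤ m → FOLBox ((s m).1.imp (s n).1) := by
    intro n m hnm
    induction m, hnm using Nat.le_induction with
    | base => exact .taut fun f hn hi => by simp only [hi]; tauto
    | succ m _ ih => exact (hg2 (s m).2 (e m)).trans ih
  have hcon : ∀ {n m B}, FOLBox ((s n).1.imp B) → ¬ FOLBox ((s m).1.imp (neg B)) := by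
    intro n m B h1 h2
    refine (s (max n m)).2 (((hs (le_max_left n m)).trans h1).mp_taut₂
      ((hs (le_max_right n m)).trans h2) fun f hn hi => ?_)
    simp only [hi, hn]; tauto
  have hdec : ∀ B, ∃ n, FOLBox ((s n).1.imp B) ∨ FOLBox ((s n).1.imp (neg B)) := by
    intro B
    obtain ⟨n, rfl⟩ := he B
    exact ⟨n + 1, hg3 (s n).2 (e n)⟩
  refine ⟨{B | ∃ n, FOLBox ((s n).1.imp B)}, ⟨?_, ?_, ?_, ?_⟩, 0, hs (n := 0) le_rfl⟩
  · exact fun hB => ⟨0, hB.mp_taut fun f hn hi => by simp only [hi]; tauto⟩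
  · rintro B C ⟨n, hn⟩ ⟨m, hm⟩
    exact ⟨max n m, ((hs (le_max_left n m)).trans hn).mp_taut₂
      ((hs (le_max_right n m)).trans hm) fun f hn hi => by simp only [hi]; tauto⟩
  · intro B
    refine ⟨fun ⟨n, hn⟩ ⟨m, hm⟩ => hcon hm hn, fun hB => ?_⟩
    obtain ⟨n, hn | hn⟩ := hdec B
    · exact absurd ⟨n, hn⟩ hB
    · exact ⟨n, hn⟩
  · rintro x C ⟨m, hm⟩
    obtain ⟨n, hn⟩ := he (neg (all x C))
    have h1 : FOLBox ((s (n + 1)).1.imp (e n)) :=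
      (hg3 (s n).2 (e n)).resolve_right fun h => hcon (n := m) (m := n + 1) (hn ▸ hm) h
    obtain ⟨y, hy, hc⟩ := hg4 (s n).2 (e n) x C hn h1
    exact ⟨y, hy, n + 1, hc⟩

namespace Henkin

variable {Γ : Set Formula}

theorem imp_mem (hΓ : Henkin Γ) {A B : Formula} : A.imp B ∈ Γ ↔ (A ∈ Γ → B ∈ Γ) := by
  refine ⟨hΓ.mp, fun h => ?_⟩
  by_contra hc
  have hc' := hΓ.neg_mem.2 hc
  have hA : A ∈ Γ := hΓ.mp (hΓ.of_folBox
    (.taut fun f hn hi => by simp only [hi, hn]; tauto)) hc'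
  exact hc (hΓ.mp (hΓ.of_folBox (.taut fun f hn hi => by simp only [hi]; tauto)) (h hA))

theorem and_mem (hΓ : Henkin Γ) {A B : Formula} : A.and B ∈ Γ ↔ A ∈ Γ ∧ B ∈ Γ := by
  simp only [Formula.and, hΓ.neg_mem, hΓ.imp_mem]; tauto

theorem subst_mem_iff (hΓ : Henkin Γ) {A : Formula} {x y : ℕ} (h : Formula.eq x y ∈ Γ)
    (hA : BoxFree A) (hs : Substitutable y x A) : A.subst y x ∈ Γ ↔ A ∈ Γ := by
  refine ⟨fun h1 => ?_, fun h1 => hΓ.mp (hΓ.of_folBox (.axEq hA hs)) (hΓ.and_mem.2 ⟨h, h1⟩)⟩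
  by_contra h2
  exact hΓ.neg_mem.1 (hΓ.mp (hΓ.of_folBox (FOLBox.axEq (A := neg A) hA hs))
    (hΓ.and_mem.2 ⟨h, hΓ.neg_mem.2 h2⟩)) h1

theorem eq_refl (hΓ : Henkin Γ) (x : ℕ) : Formula.eq x x ∈ Γ := hΓ.of_folBox .axId

theorem eq_symm (hΓ : Henkin Γ) {x y : ℕ} (h : Formula.eq x y ∈ Γ) : Formula.eq y x ∈ Γ := by
  refine (hΓ.subst_mem_iff (A := Formula.eq y x) h trivial trivial).1 ?_
  simpa [subst] using hΓ.eq_refl y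

theorem eq_trans (hΓ : Henkin Γ) {x y z : ℕ} (h : Formula.eq x y ∈ Γ)
    (h' : Formula.eq y z ∈ Γ) : Formula.eq x z ∈ Γ := by
  refine (hΓ.subst_mem_iff (A := Formula.eq x z) h trivial trivial).1 ?_
  by_cases hz : z = x
  · simpa [subst, hz] using hΓ.eq_refl y
  · simpa [subst, hz] using h'

/-- The equivalence of variables identified by `Γ`. -/
def setoid (hΓ : Henkin Γ) : Setoid ℕ where
  r x y := Formula.eq x y ∈ Γ
  iseqv := ⟨hΓ.eq_refl, hΓ.eq_symm, hΓ.eq_trans⟩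

/-- The one-world structure on classes of variables determined by `Γ`. -/
noncomputable def termStructure (hΓ : Henkin Γ) : Structure where
  W := Unit
  wNonempty := ⟨()⟩
  D _ := Quotient hΓ.setoid
  dNonempty _ := ⟨Quotient.mk _ 0⟩
  I j _ ds := Formula.atom j (ds.map Quotient.out) ∈ Γ

/-- The valuation sending each variable to its class. -/
def termVal (hΓ : Henkin Γ) : Valuation hΓ.termStructure := fun x _ => Quotient.mk hΓ.setoid x

theorem atom_map_mem_iff (hΓ : Henkin Γ) {r : ℕ → ℕ} (hr : ∀ x, Formula.eq x (r x) ∈ Γ)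
    (hrr : ∀ x, r (r x) = r x) (j : ℕ) (l : List ℕ) :
    Formula.atom j (l.map r) ∈ Γ ↔ Formula.atom j l ∈ Γ := by
  have key : ∀ L : List ℕ,
      Formula.atom j (l.map fun z => if z ∈ L then r z else z) ∈ Γ ↔ Formula.atom j l ∈ Γ := by
    intro L
    induction L with
    | nil => simp
    | cons x L ih =>
      refine Iff.trans ?_
        ((hΓ.subst_mem_iff (hr x) (A := Formula.atom j _) trivial trivial).trans ih)
      simp only [subst, List.map_map]
      refine iff_of_eq (congrArg (fun l => Formula.atom j l ∈ Γ) (List.map_congr_left ?_))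
      intro z _
      simp only [Function.comp, List.mem_cons]
      by_cases hL : z ∈ L
      · rw [if_pos (Or.inr hL), if_pos hL]
        split_ifs with hx
        · rw [← hx, hrr]
        · rfl
      · by_cases hx : z = x
        · subst hx; simp [hL]
        · simp [hL, hx]
  rw [← key l]
  refine iff_of_eq (congrArg (fun l => Formula.atom j l ∈ Γ) (List.map_congr_left ?_))
  intro z hz
  rw [if_pos hz]

/-- Every variable is identified by `Γ` with one that can be substituted for `x` in `A`. -/
theorem exists_substitutable (hΓ : Henkin Γ) (A : Formula) (x y : ℕ) :
    ∃ z, Substitutable z x A ∧ Formula.eq z y ∈ Γ := by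
  by_cases hxy : y = x
  · subst hxy
    exact ⟨y, substitutable_self A y, hΓ.eq_refl y⟩
  have h1 : neg (all x ((Formula.eq x y).imp (neg (A.imp A)))) ∈ Γ := by
    have h2 : FOLBox ((all x (neg (Formula.eq x y))).imp (neg (Formula.eq y y))) := by
      simpa [subst, hxy] using
        FOLBox.axAll1 (A := neg (Formula.eq x y)) (x := x) (y := y) trivial
    have h3 := (FOLBox.all_mono x (.taut fun f hn hi => by simp only [hi, hn]; tauto :
      FOLBox (((Formula.eq x y).imp (neg (A.imp A))).imp (neg (Formula.eq x y))))).trans h2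
    exact hΓ.neg_mem.2 fun hc =>
      hΓ.neg_mem.1 (hΓ.mp (hΓ.of_folBox h3) hc) (hΓ.eq_refl y)
  obtain ⟨z, hz, hm⟩ := hΓ.saturated _ _ h1
  refine ⟨z, hz.2.1, ?_⟩
  simp only [subst, if_neg hxy, if_true, hΓ.neg_mem, hΓ.imp_mem] at hm
  tauto

theorem sat_iff_mem (hΓ : Henkin Γ) (A : Formula) (hA : BoxFree A) :
    Sat hΓ.termStructure hΓ.termVal () A ↔ A ∈ Γ := by
  induction hn : A.size using Nat.strong_induction_on generalizing A with
  | _ n ih =>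
  subst hn
  cases A with
  | atom j l =>
    refine Iff.trans ?_ (hΓ.atom_map_mem_iff
      (r := fun x => (Quotient.mk hΓ.setoid x).out) ?_ ?_ j l)
    · simp only [Sat, termStructure, termVal, List.map_map, Function.comp_def]
    · exact fun x => hΓ.eq_symm (Quotient.mk_out (s := hΓ.setoid) x)
    · exact fun x => by simp only [Quotient.out_eq]
  | eq a b => exact Quotient.eq (r := hΓ.setoid)
  | neg A =>
    rw [hΓ.neg_mem, ← ih A.size (by simp [size]) A hA rfl]; rfl
  | imp A B =>
    rw [hΓ.imp_mem, ← ih A.size (by simp only [size]; omega) A hA.1 rfl,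
      ← ih B.size (by simp only [size]; omega) B hA.2 rfl]; rfl
  | all x A =>
    have key : ∀ y, Substitutable y x A → (A.subst y x ∈ Γ ↔
        Sat hΓ.termStructure (updateVal hΓ.termVal x () (hΓ.termVal y ())) () A) := fun y hy =>
      (ih _ (by simp [size_subst, size]) _ (boxFree_subst (A := A) hA y x) rfl).symm.trans
        (sat_subst hy _ _)
    constructor
    · intro h
      by_contra hc
      obtain ⟨y, hy, hm⟩ := hΓ.saturated x A (hΓ.neg_mem.2 hc)
      exact hΓ.neg_mem.1 hm ((key y hy).2 (h _))
    · intro h a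
      obtain ⟨y, rfl⟩ := Quotient.exists_rep a
      obtain ⟨z, hz, hzy⟩ := hΓ.exists_substitutable A x y
      have he : Quotient.mk hΓ.setoid y = hΓ.termVal z () :=
        Quotient.sound (s := hΓ.setoid) (hΓ.eq_symm hzy)
      have h2 := (key z hz).1 (hΓ.mp (hΓ.of_folBox (.axAll1 hz)) h)
      rw [← he] at h2
      exact h2
  | box A => exact hA.elim

end Henkin

/-- Completeness of FOL□ for classical first-order theses. -/
theorem folBox_of_mem_FOL {A : Formula} (h : A ∈ FOL) : FOLBox A := by
  by_contra hc
  have hcon : Con (neg A) := fun h' =>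
    hc (h'.mp_taut fun f hn hi => by simp only [hi, hn]; tauto)
  obtain ⟨Γ, hΓ, hA⟩ := hcon.exists_henkin
  exact hΓ.neg_mem.1 hA ((hΓ.sat_iff_mem A h.1).1 (h.2 _ _ _))

theorem folBox_box_or_neg_of_boxFree {A : Formula} (h : BoxFree A) :
    FOLBox (box A) ∨ FOLBox (neg (box A)) := by
  by_cases hA : A ∈ FOL
  · exact Or.inl (folBox_of_mem_FOL hA).nec
  · exact Or.inr (.axBang h hA)

/-- Every formula is provably equivalent to a □-free one. -/
theorem exists_boxFree_equiv (A : Formula) :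
    ∃ B, BoxFree B ∧ FOLBox (A.imp B) ∧ FOLBox (B.imp A) := by
  induction A with
  | atom j l => exact ⟨Formula.atom j l, trivial, .taut fun f hn hi => by simp only [hi, imp_self],
      .taut fun f hn hi => by simp only [hi, imp_self]⟩
  | eq a b => exact ⟨Formula.eq a b, trivial, .taut fun f hn hi => by simp only [hi, imp_self],
      .taut fun f hn hi => by simp only [hi, imp_self]⟩
  | neg A ih =>
    obtain ⟨B, hB, h1, h2⟩ := ih
    exact ⟨neg B, hB, h2.mp_taut fun f hn hi => by simp only [hi, hn]; tauto,
      h1.mp_taut fun f hn hi => by simp only [hi, hn]; tauto⟩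
  | imp A A' ih ih' =>
    obtain ⟨B, hB, h1, h2⟩ := ih
    obtain ⟨B', hB', h1', h2'⟩ := ih'
    exact ⟨B.imp B', ⟨hB, hB'⟩, h2.mp_taut₂ h1' fun f hn hi => by simp only [hi]; tauto,
      h1.mp_taut₂ h2' fun f hn hi => by simp only [hi]; tauto⟩
  | all x A ih =>
    obtain ⟨B, hB, h1, h2⟩ := ih
    exact ⟨all x B, hB, h1.all_mono x, h2.all_mono x⟩
  | box A ih =>
    obtain ⟨B, hB, h1, h2⟩ := ih
    rcases folBox_box_or_neg_of_boxFree hB with h | h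
    · exact ⟨Formula.eq 0 0, trivial,
        (FOLBox.axId (x := 0)).mp_taut fun f hn hi => by simp only [hi]; tauto,
        (h2.box_mono.mp h).mp_taut fun f hn hi => by simp only [hi]; tauto⟩
    · exact ⟨neg (Formula.eq 0 0), trivial,
        h1.box_mono.mp_taut₂ h fun f hn hi => by simp only [hi, hn]; tauto,
        (FOLBox.axId (x := 0)).mp_taut fun f hn hi => by simp only [hi, hn]; tauto⟩

/-- FOL□ decides every formula of the form `□A`. -/
theorem folBox_box_or_neg (A : Formula) : FOLBox (box A) ∨ FOLBox (neg (box A)) := by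
  obtain ⟨B, hB, h1, h2⟩ := exists_boxFree_equiv A
  refine (folBox_box_or_neg_of_boxFree hB).imp h2.box_mono.mp fun h =>
    h1.box_mono.mp_taut₂ h fun f hn hi => by simp only [hi, hn]; tauto

theorem notMem_of_folBox_neg {Γ : Set Formula} (hΓ : MaxConsistent Γ) {A : Formula}
    (h : FOLBox (neg A)) : A ∉ Γ := fun hA =>
  hΓ.1 [A] (by simp) (by simpa using hA) h

theorem mem_of_folBox {Γ : Set Formula} (hΓ : MaxConsistent Γ) {A : Formula}
    (h : FOLBox A) : A ∈ Γ :=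
  (hΓ.2 A).resolve_right (notMem_of_folBox_neg hΓ
    (h.mp_taut fun f hn hi => by simp only [hi, hn]; tauto))

/-- for every formula A and all Γ, Δ ∈ MC,
□A ∈ Γ iff □A ∈ Δ. -/
theorem box_agree (A : Formula) (Γ Δ : Set Formula)
    (hΓ : Γ ∈ MC) (hΔ : Δ ∈ MC) :
    Formula.box A ∈ Γ ↔ Formula.box A ∈ Δ := by
  rcases folBox_box_or_neg A with h | h
  · exact iff_of_true (mem_of_folBox hΓ.2 h) (mem_of_folBox hΔ.2 h)
  · exact iff_of_false (notMem_of_folBox_neg hΓ.2 h) (notMem_of_folBox_neg hΔ.2 h)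

end FOLBoxPaper
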